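/- Let D be a strongly connected balanced bipartite digraph of order 2a with a ≥ 3, such that d(u)+d(v) ≥ 3a whenever {u,v} is a dominating or dominated pair of vertices. Then D is Hamiltonian. -/

import Mathlib

open Finset Function

variable {V : Type*}

/-- Out-degree of a vertex in a digraph given by arc relation `A`. -/
noncomputable def outDeg (A : V → V → Prop) (u : V) : ℕ := {v | A u v}.ncard

/-- In-degree of a vertex. -/
noncomputable def inDeg (A : V → V → Prop) (u : V) : ℕ := {v | A v u}.ncard

/-- Degree `d(u) = d⁺(u) + d⁻(u)`. -/
noncomputable def deg (A : V → V → Prop) (u : V) : ℕ := outDeg A u + inDeg A u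

/-- Strong connectedness: a directed path between every ordered pair of vertices. -/
def StronglyConnected (A : V → V → Prop) : Prop :=
  ∀ u v : V, Relation.ReflTransGen A u v

/-- `X, Y` form a bipartition of the digraph `A`. -/
def IsBipartition (A : V → V → Prop) (X Y : Set V) : Prop :=
  Disjoint X Y ∧ X ∪ Y = Set.univ ∧
    ∀ u v, A u v → (u ∈ X ∧ v ∈ Y) ∨ (u ∈ Y ∧ v ∈ X)

/-- `{u,v}` is a dominating pair: a common out-neighbour exists. -/
def IsDominatingPair (A : V → V → Prop) (u v : V) : Prop :=
  u ≠ v ∧ ∃ w, A u w ∧ A v w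

/-- `{u,v}` is a dominated pair: a common in-neighbour exists. -/
def IsDominatedPair (A : V → V → Prop) (u v : V) : Prop :=
  u ≠ v ∧ ∃ w, A w u ∧ A w v

/-- The digraph contains a directed cycle of length `l`. -/
def HasCycleOfLength (A : V → V → Prop) (l : ℕ) : Prop :=
  ∃ f : ZMod l → V, Function.Injective f ∧ ∀ i, A (f i) (f (i + 1))

/-- The digraph contains a Hamiltonian (directed) cycle. -/
def IsHamiltonian [Fintype V] (A : V → V → Prop) : Prop :=
  ∃ f : ZMod (Fintype.card V) ≃ V, ∀ i, A (f i) (f (i + 1))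

/-- The digraph is exactly one directed cycle through all its vertices. -/
def IsDirectedCycleDigraph [Fintype V] (A : V → V → Prop) : Prop :=
  ∃ f : ZMod (Fintype.card V) ≃ V, ∀ u v, A u v ↔ ∃ i, u = f i ∧ v = f (i + 1)

/-- A balanced bipartite digraph of order `2a` is bipancyclic: it has cycles of
all even lengths `2, 4, …, 2a`. -/
def Bipancyclic [Fintype V] (A : V → V → Prop) (a : ℕ) : Prop :=
  ∀ l, 1 ≤ l → l ≤ a → HasCycleOfLength A (2 * l)

/-- A digraph is pancyclic: cycles of all lengths `2, …, n`. -/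
def Pancyclic [Fintype V] (A : V → V → Prop) : Prop :=
  ∀ l, 2 ≤ l → l ≤ Fintype.card V → HasCycleOfLength A l

/-- A cycle factor: a spanning collection of vertex-disjoint directed cycles,
i.e. a permutation `σ` with `v → σ v` an arc for every `v` (in a loopless
digraph all orbits have length `≥ 2`). -/
def HasCycleFactor (A : V → V → Prop) : Prop :=
  ∃ σ : Equiv.Perm V, ∀ v, A v (σ v)

/-- `arcs(S,T) = |A[S,T]| + |A[T,S]|`. -/
noncomputable def arcsCount (A : V → V → Prop) (S T : Set V) : ℕ :=
  {p : V × V | p.1 ∈ S ∧ p.2 ∈ T ∧ A p.1 p.2}.ncard +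
  {p : V × V | p.1 ∈ T ∧ p.2 ∈ S ∧ A p.1 p.2}.ncard

section

open scoped Classical

/-- The pair `{u, v}` is dominating or dominated. -/
def IsLinked (A : V → V → Prop) (u v : V) : Prop :=
  IsDominatingPair A u v ∨ IsDominatedPair A u v

theorem IsLinked.symm {A : V → V → Prop} {u v : V} (h : IsLinked A u v) : IsLinked A v u := by
  rcases h with ⟨hne, w, h1, h2⟩ | ⟨hne, w, h1, h2⟩
  · exact Or.inl ⟨hne.symm, w, h2, h1⟩
  · exact Or.inr ⟨hne.symm, w, h2, h1⟩

theorem swap_apply_mem_iff {S : Finset V} {x y : V} (hxy : x ∈ S ↔ y ∈ S) (p : V) :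
    Equiv.swap x y p ∈ S ↔ p ∈ S := by
  rw [Equiv.swap_apply_def]
  split_ifs with h1 h2
  · rw [h1, hxy]
  · rw [h2, hxy]
  · exact Iff.rfl

theorem sum_perm_of_mem_iff {σ : Equiv.Perm V} {C : Finset V} (hC : ∀ v, σ v ∈ C ↔ v ∈ C)
    (f : V → ℕ) : ∑ v ∈ C, f (σ v) = ∑ v ∈ C, f v :=
  sum_equiv σ (fun v => (hC v).symm) fun _ _ => rfl

variable [Fintype V] {A : V → V → Prop} {a : ℕ} {X : Finset V}

/-- Every arc of `A` joins `X` and its complement, and both have `a` elements. -/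
structure IsBalancedBy (A : V → V → Prop) (a : ℕ) (X : Finset V) : Prop where
  arc : ∀ ⦃u v⦄, A u v → (u ∈ X ↔ v ∉ X)
  card : #X = a
  card_compl : #Xᶜ = a

/-- The vertices on the other side of the bipartition `X, Xᶜ` than `u`. -/
noncomputable def oppositeSide (X : Finset V) (u : V) : Finset V := {v | u ∈ X ↔ v ∉ X}

/-- The number of arcs (zero or one) from `u` to `v`. -/
noncomputable def arcInd (A : V → V → Prop) (u v : V) : ℕ := if A u v then 1 else 0

theorem mem_oppositeSide {u v : V} : v ∈ oppositeSide X u ↔ (u ∈ X ↔ v ∉ X) := by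
  simp [oppositeSide]

theorem outDeg_eq_card (A : V → V → Prop) (u : V) : outDeg A u = #{v | A u v} := by
  rw [outDeg, Set.ncard_eq_toFinset_card']
  congr 1
  ext
  simp

theorem inDeg_eq_card (A : V → V → Prop) (u : V) : inDeg A u = #{v | A v u} := by
  rw [inDeg, Set.ncard_eq_toFinset_card']
  congr 1
  ext
  simp

theorem deg_eq_sum (A : V → V → Prop) (u : V) :
    deg A u = ∑ v, (arcInd A u v + arcInd A v u) := by
  simp [deg, outDeg_eq_card, inDeg_eq_card, arcInd, sum_add_distrib]

namespace IsBalancedBy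

theorem compl (h : IsBalancedBy A a X) : IsBalancedBy A a Xᶜ where
  arc u v huv := by have := h.arc huv; simp only [mem_compl]; tauto
  card := h.card_compl
  card_compl := by rw [compl_compl]; exact h.card

theorem card_oppositeSide (h : IsBalancedBy A a X) (u : V) : #(oppositeSide X u) = a := by
  by_cases hu : u ∈ X
  · rw [← h.card_compl]
    congr 1
    ext v
    simp [mem_oppositeSide, hu]
  · rw [← h.card]
    congr 1
    ext v
    simp [mem_oppositeSide, hu]

theorem filter_out_subset (h : IsBalancedBy A a X) (u : V) :
    ({v | A u v} : Finset V) ⊆ oppositeSide X u := by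
  intro v hv
  simp only [mem_filter, mem_univ, true_and] at hv
  exact mem_oppositeSide.2 (h.arc hv)

theorem filter_in_subset (h : IsBalancedBy A a X) (u : V) :
    ({v | A v u} : Finset V) ⊆ oppositeSide X u := by
  intro v hv
  simp only [mem_filter, mem_univ, true_and] at hv
  have := h.arc hv
  rw [mem_oppositeSide]
  tauto

theorem outDeg_le (h : IsBalancedBy A a X) (u : V) : outDeg A u ≤ a := by
  rw [outDeg_eq_card, ← h.card_oppositeSide u]
  exact card_le_card (h.filter_out_subset u)

theorem inDeg_le (h : IsBalancedBy A a X) (u : V) : inDeg A u ≤ a := by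
  rw [inDeg_eq_card, ← h.card_oppositeSide u]
  exact card_le_card (h.filter_in_subset u)

theorem deg_le (h : IsBalancedBy A a X) (u : V) : deg A u ≤ 2 * a := by
  have := h.outDeg_le u
  have := h.inDeg_le u
  unfold deg
  omega

theorem adj_of_le_deg (h : IsBalancedBy A a X) {u v : V} (hu : 2 * a ≤ deg A u)
    (huv : u ∈ X ↔ v ∉ X) : A u v ∧ A v u := by
  have h1 := h.outDeg_le u
  have h2 := h.inDeg_le u
  unfold deg at hu
  have h3 := eq_of_subset_of_card_le (h.filter_out_subset u)
    (by rw [h.card_oppositeSide, ← outDeg_eq_card]; omega)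
  have h4 := eq_of_subset_of_card_le (h.filter_in_subset u)
    (by rw [h.card_oppositeSide, ← inDeg_eq_card]; omega)
  have hv := mem_oppositeSide.2 huv
  constructor
  · rw [← h3] at hv; simpa using hv
  · rw [← h4] at hv; simpa using hv

theorem deg_add_two_le (h : IsBalancedBy A a X) {u v : V} (huv : u ∈ X ↔ v ∉ X)
    (h1 : ¬ A u v) (h2 : ¬ A v u) : deg A u + 2 ≤ 2 * a := by
  have hv := mem_oppositeSide.2 huv
  have h3 : #{w | A u w} < #(oppositeSide X u) :=
    card_lt_card ⟨h.filter_out_subset u, fun hs => h1 (by simpa using hs hv)⟩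
  have h4 : #{w | A w u} < #(oppositeSide X u) :=
    card_lt_card ⟨h.filter_in_subset u, fun hs => h2 (by simpa using hs hv)⟩
  rw [h.card_oppositeSide] at h3 h4
  unfold deg
  rw [outDeg_eq_card, inDeg_eq_card]
  omega

end IsBalancedBy

theorem StronglyConnected.exists_arc_of_mem_of_notMem {A : V → V → Prop}
    (hsc : StronglyConnected A) {S : Finset V} {u v : V} (hu : u ∈ S) (hv : v ∉ S) :
    ∃ p ∈ S, ∃ q ∉ S, A p q := by
  by_contra! hcon
  apply hv
  have := hsc u v
  induction this with
  | refl => exact hu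
  | tail _ hbc ih =>
    by_contra hc
    exact hcon _ (by by_contra hb; exact absurd (ih hb) hb) _ hc hbc

theorem StronglyConnected.exists_out (hsc : StronglyConnected A) (hV : 2 ≤ Fintype.card V)
    (u : V) : ∃ v, A u v := by
  have := Fintype.one_lt_card_iff_nontrivial.1 hV
  obtain ⟨w, hw⟩ := exists_ne u
  obtain ⟨p, hp, q, -, hpq⟩ := hsc.exists_arc_of_mem_of_notMem (S := {u})
    (mem_singleton_self u) (by simpa using hw)
  rw [mem_singleton] at hp
  exact ⟨q, hp ▸ hpq⟩

theorem StronglyConnected.exists_in (hsc : StronglyConnected A) (hV : 2 ≤ Fintype.card V)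
    (u : V) : ∃ v, A v u := by
  have := Fintype.one_lt_card_iff_nontrivial.1 hV
  obtain ⟨w, hw⟩ := exists_ne u
  obtain ⟨p, -, q, hq, hpq⟩ := hsc.exists_arc_of_mem_of_notMem (S := {u}ᶜ) (u := w) (v := u)
    (by simpa using hw) (by simp)
  simp only [mem_compl, mem_singleton, not_not] at hq
  exact ⟨p, hq ▸ hpq⟩

theorem IsBalancedBy.card_le_card_biUnion_out (h : IsBalancedBy A a X)
    (hdeg : ∀ u v, IsLinked A u v → 3 * a ≤ deg A u + deg A v)
    (hout : ∀ u, ∃ v, A u v) (hin : ∀ u, ∃ v, A v u) {S : Finset V} (hS : S ⊆ X) :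
    #S ≤ #(S.biUnion fun u => {v | A u v}) := by
  by_contra! hlt
  set N := S.biUnion fun u => ({v | A u v} : Finset V) with hN
  have hmemN : ∀ {u v}, u ∈ S → A u v → v ∈ N := fun {u v} hu huv =>
    mem_biUnion.2 ⟨u, hu, by simpa using huv⟩
  choose f hf using hout
  choose g hg using hin
  obtain ⟨x₁, hx₁, x₂, hx₂, hne, hfx⟩ := exists_ne_map_eq_of_card_lt_of_maps_to hlt
    (f := f) (fun u hu => hmemN hu (hf u))
  have hx := hdeg x₁ x₂ (Or.inl ⟨hne, f x₁, hf x₁, hfx ▸ hf x₂⟩)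
  have hxN : ∀ x ∈ S, outDeg A x ≤ #N := fun x hx => by
    rw [outDeg_eq_card]
    exact card_le_card fun v hv => hmemN hx (by simpa using hv)
  have hNX : N ⊆ Xᶜ := by
    intro v hv
    obtain ⟨u, hu, huv⟩ := mem_biUnion.1 hv
    have := h.arc (u := u) (v := v) (by simpa using huv)
    simpa using this.1 (hS hu)
  have hT := card_sdiff_add_card_eq_card hNX
  have hXS := card_sdiff_add_card_eq_card hS
  rw [h.card_compl] at hT
  rw [h.card] at hXS
  have hgm : ∀ y ∈ Xᶜ \ N, ∀ z, A z y → z ∈ X \ S := by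
    intro y hy z hz
    rw [mem_sdiff, mem_compl] at hy
    rw [mem_sdiff]
    exact ⟨(h.arc hz).2 hy.1, fun hzS => hy.2 (hmemN hzS hz)⟩
  obtain ⟨y₁, hy₁, y₂, hy₂, hney, hgy⟩ := exists_ne_map_eq_of_card_lt_of_maps_to
    (s := Xᶜ \ N) (t := X \ S) (f := g) (by omega) (fun y hy => hgm y hy _ (hg y))
  have hy := hdeg y₁ y₂ (Or.inr ⟨hney, g y₁, hg y₁, hgy ▸ hg y₂⟩)
  have hyN : ∀ y ∈ Xᶜ \ N, inDeg A y ≤ #(X \ S) := fun y hy => by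
    rw [inDeg_eq_card]
    exact card_le_card fun v hv => hgm y hy v (by simpa using hv)
  have := hxN _ hx₁
  have := hxN _ hx₂
  have := hyN _ hy₁
  have := hyN _ hy₂
  have := h.inDeg_le x₁
  have := h.inDeg_le x₂
  have := h.outDeg_le y₁
  have := h.outDeg_le y₂
  unfold deg at hx hy
  omega

theorem IsBalancedBy.hasCycleFactor (h : IsBalancedBy A a X)
    (hdeg : ∀ u v, IsLinked A u v → 3 * a ≤ deg A u + deg A v)
    (hout : ∀ u, ∃ v, A u v) (hin : ∀ u, ∃ v, A v u) : HasCycleFactor A := by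
  obtain ⟨f, hf, hfA⟩ := (all_card_le_biUnion_card_iff_exists_injective
    (fun u => ({v | A u v} : Finset V))).1 (by
      intro S
      have h1 := h.card_le_card_biUnion_out hdeg hout hin (S := S ∩ X) inter_subset_right
      have h2 := h.compl.card_le_card_biUnion_out hdeg hout hin (S := S \ X)
        (fun v hv => by simpa using (mem_sdiff.1 hv).2)
      have h3 := card_inter_add_card_sdiff S X
      rw [← h3]
      refine (add_le_add h1 h2).trans ?_
      rw [← card_union_of_disjoint]
      · refine card_le_card (union_subset ?_ ?_)
        · exact biUnion_subset_biUnion_of_subset_left _ inter_subset_left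
        · exact biUnion_subset_biUnion_of_subset_left _ sdiff_subset
      · rw [disjoint_left]
        intro v hv hv'
        simp only [mem_biUnion, mem_inter, mem_sdiff, mem_filter, mem_univ, true_and] at hv hv'
        obtain ⟨u, hu, huv⟩ := hv
        obtain ⟨w, hw, hwv⟩ := hv'
        have := h.arc huv
        have := h.arc hwv
        tauto)
  refine ⟨Equiv.ofBijective f (Finite.injective_iff_bijective.1 hf), fun v => ?_⟩
  simpa using hfA v

/-- A permutation all of whose points lie on one cycle gives a Hamiltonian cycle. -/
theorem isHamiltonian_of_sameCycle [Nonempty V] {σ : Equiv.Perm V} (hσ : ∀ v, A v (σ v))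
    (hs : ∀ u v, σ.SameCycle u v) : IsHamiltonian A := by
  obtain ⟨v₀⟩ := ‹Nonempty V›
  have hon : σ.IsCycleOn (univ : Finset V) :=
    ⟨by simp [Set.bijOn_univ], fun u _ v _ => hs u v⟩
  have : NeZero (Fintype.card V) := ⟨(Fintype.card_pos_iff.2 ⟨v₀⟩).ne'⟩
  have hmod : ∀ m n : ℕ, (σ ^ m) v₀ = (σ ^ n) v₀ ↔ m ≡ n [MOD Fintype.card V] := fun m n =>
    hon.pow_apply_eq_pow_apply (mem_univ v₀)
  set f : ZMod (Fintype.card V) → V := fun i => (σ ^ i.val) v₀ with hf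
  have hinj : Injective f := by
    intro i j hij
    have := (hmod _ _).1 hij
    rw [← ZMod.natCast_eq_natCast_iff] at this
    simpa using this
  have hbij : Bijective f :=
    (Fintype.bijective_iff_injective_and_card f).2 ⟨hinj, ZMod.card _⟩
  refine ⟨Equiv.ofBijective f hbij, fun i => ?_⟩
  have : f (i + 1) = σ (f i) := by
    have : (σ ^ (i + 1).val) v₀ = (σ ^ (i.val + 1)) v₀ := by
      rw [hmod, ← ZMod.natCast_eq_natCast_iff]
      simp
    rw [hf]
    simp only
    rw [this, pow_succ', Equiv.Perm.mul_apply]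
  rw [Equiv.ofBijective_apply, Equiv.ofBijective_apply, this]
  exact hσ _

theorem sameCycle_mul_swap {σ : Equiv.Perm V} {u v : V} (huv : ¬ σ.SameCycle u v) :
    (σ * Equiv.swap u v).SameCycle u v ∧
      ∀ p q, σ.SameCycle p q → (σ * Equiv.swap u v).SameCycle p q := by
  set τ := σ * Equiv.swap u v with hτ
  have hu : τ u = σ v := by simp [hτ]
  have hv : τ v = σ u := by simp [hτ]
  have hw : ∀ w, w ≠ u → w ≠ v → τ w = σ w := fun w h1 h2 => by
    simp [hτ, Equiv.swap_apply_of_ne_of_ne h1 h2]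
  have hstep : ∀ w, τ.SameCycle w (τ w) := fun w =>
    Equiv.Perm.sameCycle_apply_right.2 (Equiv.Perm.SameCycle.refl _ _)
  have hpow : ∀ k : ℕ, τ.SameCycle u ((σ ^ (k + 1)) v) := by
    intro k
    induction k with
    | zero => simpa [hu] using hstep u
    | succ k ih =>
      rw [pow_succ', Equiv.Perm.mul_apply]
      by_cases h1 : (σ ^ (k + 1)) v = v
      · rw [h1, ← hu]; exact hstep u
      · have h2 : (σ ^ (k + 1)) v ≠ u := fun h2 => huv
          (Equiv.Perm.SameCycle.symm ⟨(k + 1 : ℕ), by rwa [zpow_natCast]⟩)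
        rw [← hw _ h2 h1]
        exact ih.trans (hstep _)
  have huv' : τ.SameCycle u v := by
    have := hpow (orderOf σ - 1)
    rwa [Nat.sub_add_cancel (orderOf_pos σ), pow_orderOf_eq_one, Equiv.Perm.one_apply] at this
  have hσstep : ∀ w, τ.SameCycle w (σ w) := by
    intro w
    by_cases h1 : w = u
    · rw [h1, ← hv]; exact huv'.trans (hstep v)
    by_cases h2 : w = v
    · rw [h2, ← hu]; exact huv'.symm.trans (hstep u)
    rw [← hw w h1 h2]; exact hstep w
  refine ⟨huv', fun p q hpq => ?_⟩
  obtain ⟨n, -, rfl⟩ := hpq.exists_pow_eq'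
  induction n with
  | zero => exact Equiv.Perm.SameCycle.refl _ _
  | succ n ih =>
    rw [pow_succ', Equiv.Perm.mul_apply]
    exact (ih ⟨n, by simp⟩).trans (hσstep _)

/-- The pairs of vertices lying on a common cycle of `σ`. -/
noncomputable def sameCyclePairs (σ : Equiv.Perm V) : Finset (V × V) :=
  {p | σ.SameCycle p.1 p.2}

/-- A cycle factor with as many pairs of vertices on common cycles as possible. -/
structure IsMaxFactor (A : V → V → Prop) (σ : Equiv.Perm V) : Prop where
  arc : ∀ v, A v (σ v)
  max : ∀ τ : Equiv.Perm V, (∀ v, A v (τ v)) → #(sameCyclePairs τ) ≤ #(sameCyclePairs σ)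

theorem HasCycleFactor.exists_isMaxFactor (h : HasCycleFactor A) : ∃ σ, IsMaxFactor A σ := by
  obtain ⟨σ, hσ⟩ := h
  obtain ⟨τ, hτ, hmax⟩ := exists_max_image
    ({τ | ∀ v, A v (τ v)} : Finset (Equiv.Perm V)) (fun τ => #(sameCyclePairs τ))
    ⟨σ, by simpa using hσ⟩
  exact ⟨τ, by simpa using hτ, fun ρ hρ => hmax ρ (by simpa using hρ)⟩

theorem IsMaxFactor.not_arc_of_arc {σ : Equiv.Perm V} (h : IsMaxFactor A σ) {u v : V}
    (huv : ¬ σ.SameCycle u v) (h1 : A u (σ v)) : ¬ A v (σ u) := by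
  intro h2
  obtain ⟨hτ, hsub⟩ := sameCycle_mul_swap huv
  have hle := h.max (σ * Equiv.swap u v) (by
    intro w
    rw [Equiv.Perm.mul_apply]
    by_cases hwu : w = u
    · rwa [hwu, Equiv.swap_apply_left]
    by_cases hwv : w = v
    · rwa [hwv, Equiv.swap_apply_right]
    rw [Equiv.swap_apply_of_ne_of_ne hwu hwv]
    exact h.arc w)
  refine absurd (card_lt_card ⟨?_, fun hs => ?_⟩) hle.not_gt
  · intro p hp
    simp only [sameCyclePairs, mem_filter, mem_univ, true_and] at hp ⊢
    exact hsub _ _ hp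
  · have := @hs (u, v) (by simpa [sameCyclePairs] using hτ)
    simp only [sameCyclePairs, mem_filter, mem_univ, true_and] at this
    exact huv this

theorem card_sameCyclePairs_conj (σ π : Equiv.Perm V) :
    #(sameCyclePairs (π * σ * π⁻¹)) = #(sameCyclePairs σ) := by
  refine card_equiv (Equiv.prodCongr π⁻¹ π⁻¹) fun p => ?_
  simp [sameCyclePairs, Equiv.Perm.sameCycle_conj]

theorem IsMaxFactor.conj {σ : Equiv.Perm V} (h : IsMaxFactor A σ) (π : Equiv.Perm V)
    (hπ : ∀ v, A v ((π * σ * π⁻¹) v)) : IsMaxFactor A (π * σ * π⁻¹) :=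
  ⟨hπ, fun τ hτ => (h.max τ hτ).trans_eq (card_sameCyclePairs_conj σ π).symm⟩

theorem IsBalancedBy.mem_iff_of_isLinked (h : IsBalancedBy A a X) {u v : V}
    (huv : IsLinked A u v) : u ∈ X ↔ v ∈ X := by
  rcases huv with ⟨-, w, h1, h2⟩ | ⟨-, w, h1, h2⟩ <;>
  · have := h.arc h1
    have := h.arc h2
    tauto

theorem IsBalancedBy.exists_isLinked (h : IsBalancedBy A a X) (ha : 3 ≤ a)
    (hdeg : ∀ u v, IsLinked A u v → 3 * a ≤ deg A u + deg A v) (hsc : StronglyConnected A)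
    {σ : Equiv.Perm V} (hσ : ∀ v, A v (σ v)) (hns : ∃ u v, ¬ σ.SameCycle u v) (v : V) :
    ∃ w, IsLinked A v w := by
  by_contra! hv
  have hprop : ∀ u w, A u w → (∀ z, ¬ IsLinked A u z) → ∀ z, ¬ IsLinked A w z := by
    intro u w huw hu z hz
    have hout : ∀ p, A u p → inDeg A p ≤ 1 := by
      intro p hp
      rw [inDeg_eq_card, ← card_singleton u]
      refine card_le_card fun q hq => ?_
      rw [mem_singleton]
      by_contra hne
      exact hu q (Or.inl ⟨Ne.symm hne, p, hp, by simpa using hq⟩)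
    have hin : ∀ p, A p u → outDeg A p ≤ 1 := by
      intro p hp
      rw [outDeg_eq_card, ← card_singleton u]
      refine card_le_card fun q hq => ?_
      rw [mem_singleton]
      by_contra hne
      exact hu q (Or.inr ⟨Ne.symm hne, p, hp, by simpa using hq⟩)
    have h1 := hdeg w z hz
    have h2 := hout w huw
    have h3 := h.outDeg_le w
    have h4 := h.outDeg_le z
    have h5 := h.inDeg_le z
    unfold deg at h1
    have h6 : ¬ A u z := fun h6 => by have := hout z h6; omega
    have h7 : ¬ A z u := fun h7 => by have := hin z h7; omega
    have h8 := h.mem_iff_of_isLinked hz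
    have h9 := h.arc huw
    have := h.deg_add_two_le (u := z) (v := u) (by tauto) h7 h6
    unfold deg at this
    omega
  have hall : ∀ u z, ¬ IsLinked A u z := by
    intro u
    have := hsc v u
    induction this with
    | refl => exact hv
    | tail _ hbc ih => exact hprop _ _ hbc ih
  obtain ⟨u, w, huw⟩ := hns
  apply huw
  have := hsc u w
  clear huw
  induction this with
  | refl => exact Equiv.Perm.SameCycle.refl _ _
  | @tail b c _ hbc ih =>
    have : c = σ b := by
      by_contra hne
      exact hall c (σ b) (Or.inr ⟨hne, b, hbc, hσ b⟩)
    rw [this]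
    exact Equiv.Perm.sameCycle_apply_right.2 ih

theorem IsBalancedBy.isLinked_of_mem (h : IsBalancedBy A a X) (ha : 3 ≤ a)
    (hdeg : ∀ u v, IsLinked A u v → 3 * a ≤ deg A u + deg A v) (hlow : ∀ v, a ≤ deg A v)
    {σ : Equiv.Perm V} (hσ : IsMaxFactor A σ) (hns : ∃ u v, ¬ σ.SameCycle u v) {x₁ x₂ : V}
    (h1 : x₁ ∈ X) (h2 : x₂ ∈ X) (hne : x₁ ≠ x₂) : IsLinked A x₁ x₂ := by
  by_contra hnl
  have hout : ∀ w, A x₁ w → ¬ A x₂ w := fun w hw hw' => hnl (Or.inl ⟨hne, w, hw, hw'⟩)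
  have hin : ∀ w, A w x₁ → ¬ A w x₂ := fun w hw hw' => hnl (Or.inr ⟨hne, w, hw, hw'⟩)
  have hopp : oppositeSide X x₂ = oppositeSide X x₁ := by
    ext w; simp [mem_oppositeSide, h1, h2]
  have hd₁ : Disjoint ({w | A x₁ w} : Finset V) ({w | A x₂ w} : Finset V) := by
    rw [disjoint_left]; simpa using hout
  have hd₂ : Disjoint ({w | A w x₁} : Finset V) ({w | A w x₂} : Finset V) := by
    rw [disjoint_left]; simpa using hin
  have hs₁ : ({w | A x₁ w} : Finset V) ∪ ({w | A x₂ w} : Finset V) ⊆ oppositeSide X x₁ :=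
    union_subset (h.filter_out_subset x₁) (hopp ▸ h.filter_out_subset x₂)
  have hs₂ : ({w | A w x₁} : Finset V) ∪ ({w | A w x₂} : Finset V) ⊆ oppositeSide X x₁ :=
    union_subset (h.filter_in_subset x₁) (hopp ▸ h.filter_in_subset x₂)
  have hc₁ := card_le_card hs₁
  have hc₂ := card_le_card hs₂
  have hl₁ := hlow x₁
  have hl₂ := hlow x₂
  rw [card_union_of_disjoint hd₁, h.card_oppositeSide] at hc₁
  rw [card_union_of_disjoint hd₂, h.card_oppositeSide] at hc₂
  have hsum : deg A x₁ = a ∧ deg A x₂ = a ∧ #{w | A x₁ w} + #{w | A x₂ w} = a := by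
    unfold deg at hl₁ hl₂ ⊢
    rw [outDeg_eq_card, inDeg_eq_card] at hl₁ hl₂ ⊢
    rw [outDeg_eq_card, inDeg_eq_card]
    omega
  obtain ⟨hx₁, hx₂, hsum⟩ := hsum
  have hcover : ∀ w, w ∉ X → A x₁ w ∨ A x₂ w := by
    intro w hw
    have : w ∈ oppositeSide X x₁ := by simp [mem_oppositeSide, h1, hw]
    rw [← eq_of_subset_of_card_le hs₁
      (by rw [card_union_of_disjoint hd₁, h.card_oppositeSide, hsum])] at this
    simpa using this
  have hσX : ∀ v, σ v ∉ X ↔ v ∈ X := fun v => (h.arc (hσ.arc v)).symm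
  have hσX' : ∀ v, σ.symm v ∈ X ↔ v ∉ X := fun v => by
    rw [← hσX, Equiv.apply_symm_apply]
  have hfull : ∀ x ∈ X, x ≠ x₁ → x ≠ x₂ → 2 * a ≤ deg A x := by
    intro x hx hxx₁ hxx₂
    rcases hcover (σ x) ((hσX x).2 hx) with hA | hA
    · have := hdeg x x₁ (Or.inl ⟨hxx₁, σ x, hσ.arc x, hA⟩)
      omega
    · have := hdeg x x₂ (Or.inl ⟨hxx₂, σ x, hσ.arc x, hA⟩)
      omega
  have hcyc : ∀ x ∈ X, 2 * a ≤ deg A x → ∀ z ∈ X, ¬ σ.SameCycle x z →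
      ¬ A z (σ x) ∧ ¬ A (σ.symm x) z := by
    intro x hx hfx z hz hxz
    constructor
    · exact hσ.not_arc_of_arc hxz
        (h.adj_of_le_deg hfx (iff_of_true hx ((hσX z).2 hz))).1
    · have h3 : ¬ σ.SameCycle (σ.symm z) (σ.symm x) := by
        rw [Equiv.Perm.sameCycle_symm_apply_left, Equiv.Perm.sameCycle_symm_apply_right]
        exact fun h => hxz h.symm
      have h4 := hσ.not_arc_of_arc h3
      rw [Equiv.apply_symm_apply, Equiv.apply_symm_apply] at h4
      refine h4 (h.adj_of_le_deg hfx (iff_of_true hx ?_)).2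
      rw [hσX']
      simpa using hz
  have key : ∀ x x' : V, x ∈ X → (∀ w, A x w → ¬ A x' w) → (∀ w, A w x → ¬ A w x') →
      (∀ z ∈ X, z ≠ x → z ≠ x' → 2 * a ≤ deg A z ∧ ¬ σ.SameCycle z x) → False := by
    intro x x' hx ho hi hz
    have h3 : outDeg A x ≤ 1 := by
      rw [outDeg_eq_card, ← card_singleton (σ x)]
      refine card_le_card fun w hw => ?_
      simp only [mem_filter, mem_univ, true_and] at hw
      obtain ⟨z, rfl⟩ := σ.surjective w
      have hzX : z ∈ X := (hσX z).1 ((h.arc hw).1 hx)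
      rw [mem_singleton]
      by_contra hne
      have hz' := hz z hzX (fun h => hne (h ▸ rfl)) (fun h => ho _ hw (h ▸ hσ.arc z))
      exact (hcyc z hzX hz'.1 x hx hz'.2).1 hw
    have h4 : inDeg A x ≤ 1 := by
      rw [inDeg_eq_card, ← card_singleton (σ.symm x)]
      refine card_le_card fun w hw => ?_
      simp only [mem_filter, mem_univ, true_and] at hw
      obtain ⟨z, rfl⟩ := σ.symm.surjective w
      have hzX : z ∈ X := by
        by_contra hzX
        exact (h.arc hw).1 ((hσX' z).2 hzX) hx
      rw [mem_singleton]
      by_contra hne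
      have hz' := hz z hzX (fun h => hne (h ▸ rfl)) (fun h => hi _ hw (by
        rw [← h]
        have := hσ.arc (σ.symm z)
        rwa [Equiv.apply_symm_apply] at this))
      exact (hcyc z hzX hz'.1 x hx hz'.2).2 hw
    have := hlow x
    unfold deg at this
    omega
  obtain ⟨x₃, h3, h3'⟩ := exists_mem_notMem_of_card_lt_card (s := {x₁, x₂}) (t := X)
    (card_le_two.trans_lt (by rw [h.card]; omega))
  simp only [mem_insert, mem_singleton, not_or] at h3'
  have hf3 := hfull x₃ h3 h3'.1 h3'.2
  have hfX : ∀ z ∈ X, z ≠ x₁ → z ≠ x₂ → σ.SameCycle x₃ z := by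
    intro z hz hz₁ hz₂
    by_contra hcon
    exact (hcyc x₃ h3 hf3 z hz hcon).1
      (h.adj_of_le_deg (hfull z hz hz₁ hz₂) (iff_of_true hz ((hσX x₃).2 h3))).1
  have hX : ∀ z ∈ X, σ.SameCycle x₃ z := by
    intro z hz
    by_contra hcon
    by_cases hz₁ : z = x₁
    · subst hz₁
      exact key z x₂ hz hout hin fun y hy hy₁ hy₂ =>
        ⟨hfull y hy hy₁ hy₂, fun hc => hcon ((hfX y hy hy₁ hy₂).trans hc)⟩
    by_cases hz₂ : z = x₂
    · subst hz₂
      exact key z x₁ hz (fun w hw hw' => hout w hw' hw) (fun w hw hw' => hin w hw' hw)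
        fun y hy hy₂ hy₁ =>
          ⟨hfull y hy hy₁ hy₂, fun hc => hcon ((hfX y hy hy₁ hy₂).trans hc)⟩
    exact hcon (hfX z hz hz₁ hz₂)
  have hV : ∀ v, σ.SameCycle x₃ v := by
    intro v
    by_cases hv : v ∈ X
    · exact hX v hv
    · rw [← Equiv.Perm.sameCycle_apply_right]
      exact hX _ (by by_contra hc; exact hv ((hσX v).1 hc))
  obtain ⟨u, v, huv⟩ := hns
  exact huv ((hV u).symm.trans (hV v))

theorem mem_iff_of_sameCycle {σ : Equiv.Perm V} {C : Finset V} (hC : ∀ v, σ v ∈ C ↔ v ∈ C)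
    {u v : V} (huv : σ.SameCycle u v) : u ∈ C ↔ v ∈ C := by
  obtain ⟨n, -, rfl⟩ := huv.exists_pow_eq'
  induction n with
  | zero => exact Iff.rfl
  | succ n ih =>
    rw [pow_succ', Equiv.Perm.mul_apply, hC]
    exact ih ⟨n, by rw [zpow_natCast]⟩

/-- Two vertex sets that carry complete bipartite digraphs and are unions of cycles of a maximal
cycle factor cannot be joined by arcs in both directions between suitable sides. -/
theorem IsMaxFactor.not_arc_of_complete {σ : Equiv.Perm V} (hσ : IsMaxFactor A σ)
    (h : IsBalancedBy A a X) {C : Finset V} (hC : ∀ v, σ v ∈ C ↔ v ∈ C)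
    (hcomp : ∀ u v, (u ∈ C ↔ v ∈ C) → (u ∈ X ↔ v ∉ X) → A u v) {u v w z : V}
    (hu : u ∈ C) (hv : v ∉ C) (huv : u ∈ X ↔ v ∈ X) (hw : w ∉ C) (hz : z ∈ C)
    (huw : A u w) : ¬ A v z := by
  intro hvz
  have hu' := h.arc (hσ.arc u)
  have hv' := h.arc (hσ.arc v)
  have huwX := h.arc huw
  have hvzX := h.arc hvz
  have hCu : σ u ∈ C := (hC u).2 hu
  have hCv : σ v ∉ C := fun hc => hv ((hC v).1 hc)
  have huz : σ u ∈ X ↔ z ∈ X := by grind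
  have hvw : σ v ∈ X ↔ w ∈ X := by grind
  obtain ⟨π, hπ⟩ : ∃ π, π = Equiv.swap (σ u) z * Equiv.swap (σ v) w := ⟨_, rfl⟩
  have hπC : ∀ p, π p ∈ C ↔ p ∈ C := fun p => by
    rw [hπ, Equiv.Perm.mul_apply, swap_apply_mem_iff (iff_of_true hCu hz),
      swap_apply_mem_iff (iff_of_false hCv hw)]
  have hπX : ∀ p, π p ∈ X ↔ p ∈ X := fun p => by
    rw [hπ, Equiv.Perm.mul_apply, swap_apply_mem_iff huz, swap_apply_mem_iff hvw]
  obtain ⟨τ, hτ⟩ : ∃ τ, τ = π * σ * π⁻¹ := ⟨_, rfl⟩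
  have hτπ : ∀ p, τ (π p) = π (σ p) := fun p => by simp [hτ]
  have hτC : ∀ p, τ p ∈ C ↔ p ∈ C := fun p => by
    obtain ⟨p, rfl⟩ := π.surjective p
    rw [hτπ, hπC, hπC, hC]
  have hτX : ∀ p, p ∈ X ↔ τ p ∉ X := fun p => by
    obtain ⟨p, rfl⟩ := π.surjective p
    rw [hτπ, hπX, hπX]
    exact h.arc (hσ.arc p)
  have hmax : IsMaxFactor A τ :=
    hτ ▸ hσ.conj π fun p => hτ ▸ hcomp _ _ (hτC p).symm (hτX p)
  have hne : ∀ {p q : V} (S : Finset V), (p ∈ S ↔ q ∉ S) → p ≠ q := by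
    rintro p q S hpq rfl
    exact iff_not_self hpq
  have hfix : ∀ p, (p ∈ X ↔ u ∈ X) → π p = p := fun p hp => by
    have h1 : p ≠ σ u := hne X (hp.trans hu')
    have h2 : p ≠ z := hne X (hp.trans (huv.trans hvzX))
    have h3 : p ≠ σ v := hne X (hp.trans (huv.trans hv'))
    have h4 : p ≠ w := hne X (hp.trans huwX)
    rw [hπ, Equiv.Perm.mul_apply, Equiv.swap_apply_of_ne_of_ne h3 h4,
      Equiv.swap_apply_of_ne_of_ne h1 h2]
  have hτu : τ u = z := by
    have h1 := hτπ u
    have h2 : σ u ≠ σ v := hne C (iff_of_true hCu hCv)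
    have h3 : σ u ≠ w := hne C (iff_of_true hCu hw)
    rw [hfix u Iff.rfl, hπ, Equiv.Perm.mul_apply, Equiv.swap_apply_of_ne_of_ne h2 h3,
      Equiv.swap_apply_left] at h1
    exact h1
  have hτv : τ v = w := by
    have h1 := hτπ v
    have h2 : σ u ≠ w := hne C (iff_of_true hCu hw)
    have h3 : z ≠ w := hne C (iff_of_true hz hw)
    rw [hfix v huv.symm, hπ, Equiv.Perm.mul_apply, Equiv.swap_apply_left,
      Equiv.swap_apply_of_ne_of_ne h2.symm h3.symm] at h1
    exact h1
  refine hmax.not_arc_of_arc (u := u) (v := v) (fun hs => ?_) (hτv ▸ huw) (hτu ▸ hvz)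
  exact hv ((mem_iff_of_sameCycle hτC hs).1 hu)

theorem IsBalancedBy.two_mul_card_filter_opposite (h : IsBalancedBy A a X) {σ : Equiv.Perm V}
    (hσ : ∀ v, A v (σ v)) {C : Finset V} (hC : ∀ v, σ v ∈ C ↔ v ∈ C) (u : V) :
    2 * #{v ∈ C | u ∈ X ↔ v ∉ X} = #C ∧ 2 * #{v ∈ C | u ∈ X ↔ v ∈ X} = #C := by
  have h1 : #{v ∈ C | u ∈ X ↔ v ∉ X} = #{v ∈ C | u ∈ X ↔ v ∈ X} := by
    refine card_equiv σ fun v => ?_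
    have := h.arc (hσ v)
    simp only [mem_filter, hC]
    tauto
  have h2 := card_filter_add_card_filter_not (s := C) (fun v => u ∈ X ↔ v ∉ X)
  have h3 : #{v ∈ C | ¬(u ∈ X ↔ v ∉ X)} = #{v ∈ C | u ∈ X ↔ v ∈ X} := by
    congr 1
    ext v
    simp only [mem_filter]
    tauto
  omega

/-- If an invariant set of a maximal cycle factor and its complement both carry complete bipartite
digraphs, then the set contains two vertices at distance two on a cycle with small degree sum. -/
theorem IsMaxFactor.exists_deg_le {σ : Equiv.Perm V} (hσ : IsMaxFactor A σ)
    (h : IsBalancedBy A a X) (hsc : StronglyConnected A) {C : Finset V}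
    (hC : ∀ v, σ v ∈ C ↔ v ∈ C)
    (hcomp : ∀ u v, (u ∈ C ↔ v ∈ C) → (u ∈ X ↔ v ∉ X) → A u v) {u₀ v₀ : V}
    (hu₀ : u₀ ∈ C) (hv₀ : v₀ ∉ C) :
    ∃ y ∈ C, deg A y + deg A (σ (σ y)) ≤ 2 * #C := by
  obtain ⟨p, hp, q, hq, hpq⟩ := hsc.exists_arc_of_mem_of_notMem hu₀ hv₀
  obtain ⟨r, hr, s, hs, hrs⟩ := hsc.exists_arc_of_mem_of_notMem (S := Cᶜ) (u := v₀) (v := u₀)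
    (by simpa using hv₀) (by simpa using hu₀)
  rw [mem_compl] at hr
  rw [mem_compl, not_not] at hs
  have hpr : p ∈ X ↔ r ∉ X := by
    have := hσ.not_arc_of_complete h hC hcomp hp hr (w := q) (z := s)
    tauto
  have hle : ∀ y ∈ C, (y ∈ X ↔ r ∈ X) → deg A y ≤ #C := by
    intro y hy hyr
    have hc := (h.two_mul_card_filter_opposite hσ.arc hC y).1
    have h1 : outDeg A y ≤ #{v ∈ C | y ∈ X ↔ v ∉ X} := by
      rw [outDeg_eq_card]
      refine card_le_card fun v hv => ?_
      simp only [mem_filter, mem_univ, true_and] at hv ⊢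
      refine ⟨?_, h.arc hv⟩
      by_contra hvC
      exact hσ.not_arc_of_complete h hC hcomp hy hr hyr hvC hs hv hrs
    have h2 : inDeg A y ≤ #{v ∈ C | y ∈ X ↔ v ∉ X} := by
      rw [inDeg_eq_card]
      refine card_le_card fun v hv => ?_
      simp only [mem_filter, mem_univ, true_and] at hv ⊢
      have hvX := h.arc hv
      refine ⟨?_, by tauto⟩
      by_contra hvC
      exact hσ.not_arc_of_complete h hC hcomp hp hvC (by tauto) hq hy hpq hv
    unfold deg
    omega
  have h1 := h.arc (hσ.arc p)
  have h2 := h.arc (hσ.arc (σ p))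
  have h3 := h.arc (hσ.arc (σ (σ p)))
  refine ⟨σ p, (hC p).2 hp, ?_⟩
  have := hle (σ p) ((hC p).2 hp) (by tauto)
  have := hle (σ (σ (σ p))) (by simpa [hC] using hp) (by tauto)
  omega

theorem IsMaxFactor.two_mul_sum_deg_le {σ : Equiv.Perm V} (hσ : IsMaxFactor A σ)
    (h : IsBalancedBy A a X) {C : Finset V} (hC : ∀ v, σ v ∈ C ↔ v ∈ C) :
    2 * ∑ u ∈ C, deg A u ≤ #C * (2 * a + #C) ∧
      (#C * (2 * a + #C) ≤ 2 * ∑ u ∈ C, deg A u →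
        ∀ u ∈ C, ∀ v ∈ C, (u ∈ X ↔ v ∉ X) → A u v) := by
  have hCc : ∀ v, σ v ∈ Cᶜ ↔ v ∈ Cᶜ := fun v => by simp [hC]
  have hcard : #C + #Cᶜ = 2 * a := by
    rw [card_add_card_compl, two_mul]
    nth_rewrite 1 [← h.card]
    rw [← h.card_compl, card_add_card_compl]
  have hsplit : ∑ u ∈ C, deg A u = ∑ u ∈ C, ∑ v ∈ C, (arcInd A u v + arcInd A v u) +
      ∑ u ∈ C, ∑ v ∈ Cᶜ, (arcInd A u (σ v) + arcInd A v (σ u)) := by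
    have h1 : ∑ u ∈ C, ∑ v ∈ Cᶜ, (arcInd A u (σ v) + arcInd A v (σ u)) =
        ∑ u ∈ C, ∑ v ∈ Cᶜ, (arcInd A u v + arcInd A v u) := by
      simp only [sum_add_distrib]
      congr 1
      · exact sum_congr rfl fun u _ => sum_perm_of_mem_iff hCc fun v => arcInd A u v
      · exact sum_perm_of_mem_iff hC fun u => ∑ v ∈ Cᶜ, arcInd A v u
    rw [h1, ← sum_add_distrib]
    refine sum_congr rfl fun u _ => ?_
    rw [deg_eq_sum, sum_add_sum_compl]
  have hin : ∀ u ∈ C, ∀ v ∈ C,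
      arcInd A u v + arcInd A v u ≤ if (u ∈ X ↔ v ∉ X) then 2 else 0 := by
    intro u _ v _
    have h1 := @h.arc u v
    have h2 := @h.arc v u
    unfold arcInd
    split_ifs <;> first | omega | tauto
  have hbetween : ∀ u ∈ C, ∀ v ∈ Cᶜ,
      arcInd A u (σ v) + arcInd A v (σ u) ≤ if (u ∈ X ↔ v ∈ X) then 1 else 0 := by
    intro u hu v hv
    rw [mem_compl] at hv
    have h1 := @h.arc u (σ v)
    have h2 := @h.arc v (σ u)
    have h3 := h.arc (hσ.arc u)
    have h4 := h.arc (hσ.arc v)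
    have h5 := hσ.not_arc_of_arc (u := u) (v := v)
      (fun hs => hv ((mem_iff_of_sameCycle hC hs).1 hu))
    unfold arcInd
    split_ifs <;> first | omega | tauto
  have hinSum : 2 * ∑ u ∈ C, ∑ v ∈ C, (if (u ∈ X ↔ v ∉ X) then 2 else 0) = #C * (2 * #C) := by
    rw [mul_sum, sum_const_nat]
    intro u _
    have := (h.two_mul_card_filter_opposite hσ.arc hC u).1
    rw [← sum_filter, sum_const, smul_eq_mul]
    omega
  have hbetweenSum :
      2 * ∑ u ∈ C, ∑ v ∈ Cᶜ, (if (u ∈ X ↔ v ∈ X) then 1 else 0) = #C * #Cᶜ := by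
    rw [mul_sum, sum_const_nat]
    intro u _
    have := (h.two_mul_card_filter_opposite hσ.arc hCc u).2
    rw [← sum_filter, sum_const, smul_eq_mul]
    omega
  have hle₁ := sum_le_sum fun u hu => sum_le_sum (hin u hu)
  have hle₂ := sum_le_sum fun u hu => sum_le_sum (hbetween u hu)
  have htot : #C * (2 * a + #C) = #C * (2 * #C) + #C * #Cᶜ := by
    rw [← hcard]; ring
  refine ⟨by omega, fun hge u hu v hv huv => ?_⟩
  have heq := (sum_eq_sum_iff_of_le fun u hu => sum_le_sum (hin u hu)).1 (by omega) u hu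
  have heq := (sum_eq_sum_iff_of_le (hin u hu)).1 heq v hv
  rw [if_pos huv] at heq
  by_contra hA
  unfold arcInd at heq
  rw [if_neg hA] at heq
  split_ifs at heq <;> omega

theorem IsBalancedBy.card_add_card_compl (h : IsBalancedBy A a X) (C : Finset V) :
    #C + #Cᶜ = 2 * a := by
  rw [Finset.card_add_card_compl, ← Finset.card_add_card_compl X, h.card, h.card_compl, two_mul]

theorem IsBalancedBy.mem_iff_apply_apply (h : IsBalancedBy A a X) {σ : Equiv.Perm V}
    (hσ : ∀ v, A v (σ v)) (v : V) : σ (σ v) ∈ X ↔ v ∈ X := by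
  have h1 := h.arc (hσ v)
  have h2 := h.arc (hσ (σ v))
  tauto

theorem IsMaxFactor.apply_apply_ne {σ : Equiv.Perm V} (hσ : IsMaxFactor A σ)
    (h : IsBalancedBy A a X) (ha : 3 ≤ a) (hsc : StronglyConnected A)
    (hlow : ∀ v, a ≤ deg A v)
    (hpair : ∀ u v, u ≠ v → (u ∈ X ↔ v ∈ X) → 3 * a ≤ deg A u + deg A v) (x : V) :
    σ (σ x) ≠ x := by
  intro hx
  set C : Finset V := {x, σ x} with hCdef
  have hmemC : ∀ v, v ∈ C ↔ v = x ∨ v = σ x := fun v => by simp [hCdef]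
  have hC : ∀ v, σ v ∈ C ↔ v ∈ C := by
    intro v
    rw [hmemC, hmemC, σ.injective.eq_iff]
    nth_rewrite 1 [← hx]
    rw [σ.injective.eq_iff, or_comm]
  have hne : ∀ v, v ≠ σ v := by
    intro v hv
    have := h.arc (hσ.arc v)
    rw [← hv] at this
    exact iff_not_self this
  have hcard : #C = 2 := card_pair (hne x)
  have hsum : deg A x + deg A (σ x) ≤ 2 * a + 2 := by
    have := (hσ.two_mul_sum_deg_le h hC).1
    rw [hcard, sum_pair (hne x)] at this
    omega
  have hsucc : ∀ t, σ (σ t) = t → deg A t + deg A (σ t) ≤ 2 * a + 2 → a + 1 ≤ deg A t := by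
    intro t ht hle
    by_contra! hlt
    have hadj : ∀ z ∈ oppositeSide X (σ t), A (σ t) z ∧ A z (σ t) := by
      intro z hz
      rw [mem_oppositeSide] at hz
      by_cases hzt : z = t
      · subst hzt
        exact ⟨by simpa [ht] using hσ.arc (σ z), hσ.arc z⟩
      · have ht' := h.arc (hσ.arc t)
        have := hpair z t hzt (by tauto)
        exact (h.adj_of_le_deg (u := z) (v := σ t) (by omega) (by tauto)).symm
    have h1 : a ≤ outDeg A (σ t) := by
      rw [outDeg_eq_card, ← h.card_oppositeSide (σ t)]
      exact card_le_card fun z hz => by simpa using (hadj z hz).1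
    have h2 : a ≤ inDeg A (σ t) := by
      rw [inDeg_eq_card, ← h.card_oppositeSide (σ t)]
      exact card_le_card fun z hz => by simpa using (hadj z hz).2
    have := hlow t
    unfold deg at *
    omega
  have hx1 := hsucc x hx hsum
  have hx2 := hsucc (σ x) (by rw [hx]) (by rw [hx]; omega)
  have hdegC : ∀ t ∈ C, deg A t = a + 1 := by
    intro t ht
    rcases (hmemC t).1 ht with rfl | rfl <;> omega
  have hinv : ∀ t ∈ C, σ (σ t) = t := by
    intro t ht
    rcases (hmemC t).1 ht with rfl | rfl
    · exact hx
    · rw [hx]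
  have hout : ∀ v ∉ C, ∀ w ∉ C, (v ∈ X ↔ w ∉ X) → A v w := by
    intro v hv w hw hvw
    obtain ⟨t, htC, hvt⟩ : ∃ t ∈ C, v ∈ X ↔ t ∉ X := by
      have := h.arc (hσ.arc x)
      by_cases hvx : v ∈ X ↔ x ∉ X
      · exact ⟨x, by simp [hCdef], hvx⟩
      · exact ⟨σ x, by simp [hCdef], by tauto⟩
    have hσt := h.arc (hσ.arc t)
    have hσtC := (hC t).2 htC
    have hge : ∀ z, z ≠ σ t → (z ∈ X ↔ t ∉ X) → 2 * a ≤ deg A z + 1 := by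
      intro z hz hzt
      have := hpair z (σ t) hz (by tauto)
      have := hdegC _ hσtC
      omega
    have htσ : A (σ t) t := by simpa [hinv t htC] using hσ.arc (σ t)
    have hone : oppositeSide X t ⊆ ({z | A t z} : Finset V) ∪ ({z | A z t} : Finset V) := by
      intro z hz
      rw [mem_oppositeSide] at hz
      simp only [mem_union, mem_filter, mem_univ, true_and]
      by_cases hzt : z = σ t
      · exact Or.inl (hzt ▸ hσ.arc t)
      · by_contra! hcon
        have := h.deg_add_two_le (u := z) (v := t) (by tauto) hcon.2 hcon.1
        have := hge z hzt (by tauto)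
        omega
    have hvσt : v ≠ σ t := fun hc => hv (hc ▸ hσtC)
    have hnot : ¬ (A t v ∧ A v t) := by
      rintro ⟨h1, h2⟩
      have hsub : ({v, σ t} : Finset V) ⊆
          ({z | A t z} : Finset V) ∩ ({z | A z t} : Finset V) := by
        intro z hz
        simp only [mem_insert, mem_singleton] at hz
        simp only [mem_inter, mem_filter, mem_univ, true_and]
        rcases hz with rfl | rfl
        · exact ⟨h1, h2⟩
        · exact ⟨hσ.arc t, htσ⟩
      have h3 := card_le_card hsub
      have h4 := card_le_card hone
      have h5 := card_union_add_card_inter ({z | A t z} : Finset V) ({z | A z t} : Finset V)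
      have h6 := hdegC t htC
      rw [card_pair hvσt] at h3
      rw [h.card_oppositeSide] at h4
      unfold deg at h6
      rw [outDeg_eq_card, inDeg_eq_card] at h6
      omega
    by_contra hcon
    have hd := hge v hvσt hvt
    unfold deg at hd
    rw [outDeg_eq_card, inDeg_eq_card] at hd
    have hwO : w ∈ oppositeSide X v := mem_oppositeSide.2 hvw
    have htO : t ∈ oppositeSide X v := mem_oppositeSide.2 hvt
    have ho := card_sdiff_add_card_eq_card (h.filter_out_subset v)
    have hi := card_sdiff_add_card_eq_card (h.filter_in_subset v)
    rw [h.card_oppositeSide] at ho hi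
    have hwt : w ≠ t := fun hc => hw (hc ▸ htC)
    by_cases hvt' : A v t
    · have h1 : 0 < #(oppositeSide X v \ ({z | A v z} : Finset V)) :=
        card_pos.2 ⟨w, by simp [hwO, hcon]⟩
      have h2 : 0 < #(oppositeSide X v \ ({z | A z v} : Finset V)) :=
        card_pos.2 ⟨t, by simp only [mem_sdiff, mem_filter]; tauto⟩
      omega
    · have h1 : 1 < #(oppositeSide X v \ ({z | A v z} : Finset V)) :=
        one_lt_card.2 ⟨w, by simp [hwO, hcon], t, by simp [htO, hvt'], hwt⟩
      omega
  obtain ⟨y₀, hy₀⟩ : ∃ y, y ∉ C := by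
    by_contra! hall
    have := h.card_add_card_compl C
    rw [eq_univ_of_forall hall, compl_univ, card_empty, ← eq_univ_of_forall hall, hcard] at this
    omega
  obtain ⟨y, hyC, hy⟩ := hσ.exists_deg_le h hsc hC (fun u v huv huvX => by
    by_cases hu : u ∈ C
    · have hv := huv.1 hu
      rw [hmemC] at hu hv
      rcases hu with rfl | rfl <;> rcases hv with rfl | rfl
      · exact absurd huvX iff_not_self
      · exact hσ.arc _
      · simpa [hx] using hσ.arc (σ v)
      · exact absurd huvX iff_not_self
    · exact hout u hu v (fun hv => hu (huv.2 hv)) huvX) (by simp [hCdef] : x ∈ C) hy₀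
  rw [hinv y hyC, hdegC y hyC, hcard] at hy
  omega

theorem IsMaxFactor.sameCycle {σ : Equiv.Perm V} (hσ : IsMaxFactor A σ)
    (h : IsBalancedBy A a X) (ha : 3 ≤ a) (hsc : StronglyConnected A)
    (hlow : ∀ v, a ≤ deg A v)
    (hpair : ∀ u v, u ≠ v → (u ∈ X ↔ v ∈ X) → 3 * a ≤ deg A u + deg A v) (u₀ v₀ : V) :
    σ.SameCycle u₀ v₀ := by
  by_contra hns
  have hne := hσ.apply_apply_ne h ha hsc hlow hpair
  set cyc : V → Finset V := fun u => {v | σ.SameCycle u v} with hcyc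
  have hmem : ∀ {u v}, v ∈ cyc u ↔ σ.SameCycle u v := fun {u v} => by simp [hcyc]
  have hC : ∀ u v, σ v ∈ cyc u ↔ v ∈ cyc u := fun u v => by
    rw [hmem, hmem, Equiv.Perm.sameCycle_apply_right]
  have hself : ∀ u, u ∈ cyc u := fun u => hmem.2 (Equiv.Perm.SameCycle.refl _ _)
  have hsmall : ∀ u, #(cyc u) ≤ a →
      #(cyc u) = a ∧ ∀ p ∈ cyc u, ∀ q ∈ cyc u, (p ∈ X ↔ q ∉ X) → A p q := by
    intro u hu
    obtain ⟨h1, h2⟩ := hσ.two_mul_sum_deg_le h (hC u)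
    have h3 : #(cyc u) * (3 * a) ≤ 2 * ∑ v ∈ cyc u, deg A v := by
      have h4 : ∑ v ∈ cyc u, deg A (σ (σ v)) = ∑ v ∈ cyc u, deg A v := by
        rw [sum_perm_of_mem_iff (hC u) (fun v => deg A (σ v)), sum_perm_of_mem_iff (hC u)]
      rw [two_mul]
      nth_rewrite 2 [← h4]
      rw [← sum_add_distrib, ← smul_eq_mul]
      exact card_nsmul_le_sum _ _ _ fun v _ =>
        hpair v _ (hne v).symm (h.mem_iff_apply_apply hσ.arc v).symm
    have h5 : 3 * a ≤ 2 * a + #(cyc u) :=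
      Nat.le_of_mul_le_mul_left (h3.trans h1) (card_pos.2 ⟨u, hself u⟩)
    have h6 : #(cyc u) = a := by omega
    refine ⟨h6, h2 ?_⟩
    rw [h6] at h3 ⊢
    linarith
  have hsub : cyc v₀ ⊆ (cyc u₀)ᶜ := by
    intro v hv
    rw [mem_compl]
    exact fun hv' => hns ((hmem.1 hv').trans (hmem.1 hv).symm)
  have hle := card_le_card hsub
  have htot := h.card_add_card_compl (cyc u₀)
  have hsum : #(cyc u₀) = a ∧ #(cyc v₀) = a := by
    have := hsmall u₀
    have := hsmall v₀
    omega
  have heq := eq_of_subset_of_card_le hsub (by omega)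
  obtain ⟨y, -, hy⟩ := hσ.exists_deg_le h hsc (hC u₀) (fun p q hpq hX => by
    by_cases hp : p ∈ cyc u₀
    · exact (hsmall u₀ hsum.1.le).2 p hp q (hpq.1 hp) hX
    · have hq : q ∉ cyc u₀ := fun hq => hp (hpq.2 hq)
      rw [← mem_compl, ← heq] at hp hq
      exact (hsmall v₀ hsum.2.le).2 p hp q hq hX) (hself u₀) (fun hv => hns (hmem.1 hv))
  have := hpair y _ (hne y).symm (h.mem_iff_apply_apply hσ.arc y).symm
  omega

theorem IsBalancedBy.isHamiltonian (h : IsBalancedBy A a X) (ha : 3 ≤ a)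
    (hsc : StronglyConnected A)
    (hdeg : ∀ u v, IsLinked A u v → 3 * a ≤ deg A u + deg A v) : IsHamiltonian A := by
  have hV : Fintype.card V = 2 * a := by
    rw [← Finset.card_add_card_compl X, h.card, h.card_compl, two_mul]
  have : Nonempty V := Fintype.card_pos_iff.1 (by omega)
  obtain ⟨σ, hσ⟩ := (h.hasCycleFactor hdeg (hsc.exists_out (by omega))
    (hsc.exists_in (by omega))).exists_isMaxFactor
  refine isHamiltonian_of_sameCycle hσ.arc fun u v => ?_
  by_contra hns
  have hns : ∃ u v, ¬ σ.SameCycle u v := ⟨u, v, hns⟩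
  have hlow : ∀ v, a ≤ deg A v := by
    intro v
    obtain ⟨w, hw⟩ := h.exists_isLinked ha hdeg hsc hσ.arc hns v
    have := hdeg v w hw
    have := h.deg_le w
    omega
  have hpair : ∀ u v, u ≠ v → (u ∈ X ↔ v ∈ X) → 3 * a ≤ deg A u + deg A v := by
    intro u v hne huv
    apply hdeg
    by_cases hu : u ∈ X
    · exact h.isLinked_of_mem ha hdeg hlow hσ hns hu (huv.1 hu) hne
    · exact h.compl.isLinked_of_mem ha hdeg hlow hσ hns (mem_compl.2 hu)
        (mem_compl.2 fun hv => hu (huv.2 hv)) hne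
  obtain ⟨u, v, huv⟩ := hns
  exact huv (hσ.sameCycle h ha hsc hlow hpair u v)

end

/-- degree condition on dominating or dominated pairs implies hamiltonicity. -/
theorem stmt_1 {V : Type*} [Fintype V] (A : V → V → Prop) (a : ℕ) (X Y : Set V)
    (ha : 3 ≤ a) (hcard : Fintype.card V = 2 * a)
    (hbip : IsBipartition A X Y) (hX : X.ncard = a) (hY : Y.ncard = a)
    (hsc : StronglyConnected A)
    (hdeg : ∀ u v : V, IsDominatingPair A u v ∨ IsDominatedPair A u v →
      3 * a ≤ deg A u + deg A v) :
    IsHamiltonian A := by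
  classical
  refine IsBalancedBy.isHamiltonian (X := X.toFinset) ⟨fun u v huv => ?_, ?_, ?_⟩ ha hsc hdeg
  · have hd := Set.disjoint_left.1 hbip.1
    have := hbip.2.2 u v huv
    simp only [Set.mem_toFinset]
    rcases this with ⟨hu, hv⟩ | ⟨hu, hv⟩
    · exact iff_of_true hu fun hv' => hd hv' hv
    · exact iff_of_false (fun hu' => hd hu' hu) (not_not.2 hv)
  · rw [← Set.ncard_eq_toFinset_card', hX]
  · rw [card_compl, ← Set.ncard_eq_toFinset_card', hX, hcard]
    omega
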